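/- arXiv:2303.14057 — 7 statements merged into one kernel-verified Lean document; each statement's English description precedes it below -/
import Mathlib

section
/- Let f(x) and g(x) be formal power series over ℚ with f(0) = 1 and g(0) = 0. Suppose every coefficient of the power series 1/f(x) is nonnegative and every coefficient of g(x) is nonnegative. Then every coefficient of the power series 1/(f(x) - g(x)) is nonnegative. -/
namespace PowerSeries

theorem coeff_mul_nonneg {R : Type*} [Semiring R] [PartialOrder R] [IsOrderedRing R]
    {a b : PowerSeries R} (ha : ∀ n, 0 ≤ coeff n a) (hb : ∀ n, 0 ≤ coeff n b) (n : ℕ) :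
    0 ≤ coeff n (a * b) := by
  rw [coeff_mul]
  exact Finset.sum_nonneg fun p _ => mul_nonneg (ha p.1) (hb p.2)

/-- A solution of the renewal equation `h = a + b * h`, where `b` has zero constant term, has
nonnegative coefficients as soon as `a` and `b` do. -/
theorem coeff_nonneg_of_eq_add_mul {R : Type*} [Semiring R] [PartialOrder R] [IsOrderedRing R]
    {a b h : PowerSeries R} (ha : ∀ n, 0 ≤ coeff n a) (hb : ∀ n, 0 ≤ coeff n b)
    (hb0 : constantCoeff b = 0) (heq : h = a + b * h) (n : ℕ) : 0 ≤ coeff n h := by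
  induction n using Nat.strong_induction_on with
  | _ n ih =>
    rw [heq, map_add, coeff_mul]
    refine add_nonneg (ha n) (Finset.sum_nonneg fun p hp => ?_)
    rw [Finset.HasAntidiagonal.mem_antidiagonal] at hp
    rcases Nat.eq_zero_or_pos p.1 with h0 | hpos
    · rw [h0, coeff_zero_eq_constantCoeff_apply, hb0, zero_mul]
    · exact mul_nonneg (hb p.1) (ih p.2 (by omega))

end PowerSeries

/-- If `f, g ∈ ℚ[[x]]` with `f(0) = 1`, `g(0) = 0`, all coefficients of
`1/f` nonnegative and all coefficients of `g` nonnegative, then all coefficients of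
`1/(f - g)` are nonnegative. -/
theorem stmt4 (f g : PowerSeries ℚ)
    (hf : PowerSeries.constantCoeff f = 1)
    (hg : PowerSeries.constantCoeff g = 0)
    (hfinv : ∀ n, 0 ≤ PowerSeries.coeff n f⁻¹)
    (hgpos : ∀ n, 0 ≤ PowerSeries.coeff n g) :
    ∀ n, 0 ≤ PowerSeries.coeff n (f - g)⁻¹ := by
  have hinv : f⁻¹ * f = 1 := PowerSeries.inv_mul_cancel f (by simp [hf])
  have hsub : (f - g) * (f - g)⁻¹ = 1 := PowerSeries.mul_inv_cancel (f - g) (by simp [hf, hg])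
  refine PowerSeries.coeff_nonneg_of_eq_add_mul hfinv
    (PowerSeries.coeff_mul_nonneg hfinv hgpos) (by simp [hg]) ?_
  linear_combination f⁻¹ * hsub - (f - g)⁻¹ * hinv
end

section
/- Let m be a positive integer. Suppose that the reciprocal of the formal power series 1 + Σ_{k=1}^{2m-1} (-1)^k x^k/k! + Σ_{k≥m+1} x^{2k}/(2k)! (corresponding to A ∪ B = {1,...,2m-1} ∪ {2m+2, 2m+4, ...}) has all coefficients nonnegative. Then for every A contained in the odd positive integers and B contained in the even positive integers with 1 ∈ A, such that the smallest positive integer not in A ∪ B is 2m, the reciprocal of 1 - Σ_{a∈A} x^a/a! + Σ_{b∈B} x^b/b! also has all coefficients nonnegative. -/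
open scoped Classical

/-- If `F₀⁻¹` and `D` have nonnegative coefficients and `D` has zero constant term, then
`(F₀ - D)⁻¹ = F₀⁻¹ (1 - D F₀⁻¹)⁻¹` has nonnegative coefficients. -/
theorem PowerSeries.coeff_inv_sub_nonneg {K : Type*} [Field K] [LinearOrder K]
    [IsStrictOrderedRing K] {F₀ D : PowerSeries K}
    (hF : PowerSeries.constantCoeff F₀ ≠ 0) (hD0 : PowerSeries.constantCoeff D = 0)
    (hG : ∀ n, 0 ≤ PowerSeries.coeff n F₀⁻¹) (hD : ∀ n, 0 ≤ PowerSeries.coeff n D) (n : ℕ) :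
    0 ≤ PowerSeries.coeff n (F₀ - D)⁻¹ := by
  have hFD : PowerSeries.constantCoeff (F₀ - D) ≠ 0 := by simpa [hD0] using hF
  have hrec : (F₀ - D)⁻¹ = F₀⁻¹ + F₀⁻¹ * D * (F₀ - D)⁻¹ := by
    have h₁ := PowerSeries.mul_inv_cancel _ hFD
    have h₂ := PowerSeries.mul_inv_cancel _ hF
    linear_combination F₀⁻¹ * h₁ - (F₀ - D)⁻¹ * h₂
  have hGD : ∀ k, 0 ≤ PowerSeries.coeff k (F₀⁻¹ * D) := fun k => by
    rw [PowerSeries.coeff_mul]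
    exact Finset.sum_nonneg fun p _ => mul_nonneg (hG _) (hD _)
  induction n using Nat.strong_induction_on with
  | _ n ih =>
    rw [hrec, map_add, PowerSeries.coeff_mul]
    refine add_nonneg (hG n) (Finset.sum_nonneg fun p hp => ?_)
    have hp' := Finset.HasAntidiagonal.mem_antidiagonal.mp hp
    rcases Nat.eq_zero_or_pos p.1 with h | h
    · simp [h, hD0]
    · exact mul_nonneg (hGD _) (ih _ (by omega))

/-- Fix `m ≥ 1`. If the reciprocal of
`1 + ∑_{k=1}^{2m-1} (-1)^k x^k/k! + ∑_{k ≥ m+1} x^{2k}/(2k)!`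
(corresponding to `A ∪ B = {1, ..., 2m-1} ∪ {2m+2, 2m+4, ...}`) has all coefficients
nonnegative, then for every `A` contained in the odd positive integers with `1 ∈ A` and `B`
contained in the even positive integers such that the smallest positive integer missing
from `A ∪ B` is `2m`, the reciprocal of `1 - ∑_{a ∈ A} x^a/a! + ∑_{b ∈ B} x^b/b!` also has
all coefficients nonnegative. -/
theorem stmt5 (m : ℕ) (hm : 1 ≤ m)
    (hrec : ∀ n, 0 ≤ PowerSeries.coeff (R := ℚ) n
      (PowerSeries.mk fun k =>
          (if k = 0 then (1 : ℚ) else 0)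
          + (if 1 ≤ k ∧ k ≤ 2 * m - 1 then (-1 : ℚ) ^ k / k.factorial else 0)
          + (if Even k ∧ 2 * m + 2 ≤ k then (1 : ℚ) / k.factorial else 0))⁻¹) :
    ∀ A B : Set ℕ,
      (∀ a ∈ A, Odd a ∧ 0 < a) →
      (∀ b ∈ B, Even b ∧ 0 < b) →
      1 ∈ A →
      2 * m ∉ A ∪ B →
      (∀ j, 1 ≤ j → j < 2 * m → j ∈ A ∪ B) →
      ∀ n, 0 ≤ PowerSeries.coeff (R := ℚ) n
        (PowerSeries.mk fun k =>
            (if k = 0 then (1 : ℚ) else 0)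
            - (if k ∈ A then (1 : ℚ) / k.factorial else 0)
            + (if k ∈ B then (1 : ℚ) / k.factorial else 0))⁻¹ := by
  intro A B hA hB _ hm' hj
  set F₀ : PowerSeries ℚ := PowerSeries.mk fun k =>
    (if k = 0 then (1 : ℚ) else 0)
      + (if 1 ≤ k ∧ k ≤ 2 * m - 1 then (-1 : ℚ) ^ k / k.factorial else 0)
      + (if Even k ∧ 2 * m + 2 ≤ k then (1 : ℚ) / k.factorial else 0) with hF₀
  let D : PowerSeries ℚ := PowerSeries.mk fun k =>
    if 2 * m < k ∧ (k ∈ A ∨ Even k ∧ k ∉ B) then (1 : ℚ) / k.factorial else 0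
  have hsub : (PowerSeries.mk fun k =>
      (if k = 0 then (1 : ℚ) else 0)
      - (if k ∈ A then (1 : ℚ) / k.factorial else 0)
      + (if k ∈ B then (1 : ℚ) / k.factorial else 0)) = F₀ - D := by
    ext k
    simp only [hF₀, D, map_sub, PowerSeries.coeff_mk]
    have hA' : k ∈ A → ¬ Even k := fun h => Nat.not_even_iff_odd.mpr (hA k h).1
    have hB' : k ∈ B → Even k := fun h => (hB k h).1
    have h0A : k ∈ A → 0 < k := fun h => (hA k h).2
    have h0B : k ∈ B → 0 < k := fun h => (hB k h).2
    have hjk := hj k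
    simp only [Set.mem_union] at hm' hjk
    rcases Nat.eq_zero_or_pos k with rfl | hk
    · simp [mt h0A, mt h0B]
    rcases lt_trichotomy k (2 * m) with hlt | rfl | hgt
    · by_cases he : Even k
      · have h₁ : k ∉ A := fun h => hA' h he
        have h₂ : k ∈ B := (hjk hk hlt).resolve_left h₁
        simp [h₁, h₂, hk.ne', he.neg_one_pow, show 1 ≤ k from hk, show k ≤ 2 * m - 1 by omega,
          show ¬ 2 * m + 2 ≤ k by omega, show ¬ 2 * m < k by omega]
      · have h₂ : k ∉ B := fun h => he (hB' h)
        have h₁ : k ∈ A := (hjk hk hlt).resolve_right h₂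
        simp [h₁, h₂, hk.ne', (Nat.not_even_iff_odd.mp he).neg_one_pow, show 1 ≤ k from hk,
          show k ≤ 2 * m - 1 by omega, he, show ¬ 2 * m < k by omega, neg_div]
    · have h₁ : 2 * m ∉ A := fun h => hm' (Or.inl h)
      have h₂ : 2 * m ∉ B := fun h => hm' (Or.inr h)
      simp [h₁, h₂, show m ≠ 0 by omega, show ¬ 2 * m ≤ 2 * m - 1 by omega]
    · by_cases he : Even k
      · have h₁ : k ∉ A := fun h => hA' h he
        have h₃ : 2 * m + 2 ≤ k := by
          obtain ⟨r, rfl⟩ := he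
          omega
        by_cases h₂ : k ∈ B <;>
          simp [h₁, h₂, hk.ne', he, h₃, hgt, show ¬ k ≤ 2 * m - 1 by omega]
      · have h₂ : k ∉ B := fun h => he (hB' h)
        by_cases h₁ : k ∈ A <;>
          simp [h₁, h₂, hk.ne', he, hgt, show ¬ k ≤ 2 * m - 1 by omega]
  rw [hsub]
  refine PowerSeries.coeff_inv_sub_nonneg ?_ ?_ hrec fun k => ?_
  · simp [hF₀, ← PowerSeries.coeff_zero_eq_constantCoeff_apply]
  · simp [D, ← PowerSeries.coeff_zero_eq_constantCoeff_apply]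
  · simp only [D, PowerSeries.coeff_mk]
    split_ifs <;> positivity
end

section
/- Let f(x) = 1 - x + Σ_{k even, k≥4} x^k/k!, a formal power series over ℝ. Then every coefficient of the reciprocal power series 1/f(x) is nonnegative. -/
/-- Tail bound for the exponential series at `3 / 2`, with enough room left for induction. -/
lemma sum_exp_tail_le (m : ℕ) :
    ∑ k ∈ Finset.range (m + 4), (if 4 ≤ k then (3 / 2 : ℝ) ^ k / k.factorial else 0)
      ≤ 1 / 2 - 2 * ((3 / 2 : ℝ) ^ (m + 4) / (m + 4).factorial) := by
  induction m with
  | zero => norm_num [Finset.sum_range_succ, Nat.factorial]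
  | succ m ih =>
    rw [show m + 1 + 4 = (m + 4) + 1 by ring, Finset.sum_range_succ, if_pos (by omega)]
    have hu : (0 : ℝ) ≤ (3 / 2 : ℝ) ^ (m + 4) / (m + 4).factorial := by positivity
    have hstep : (3 / 2 : ℝ) ^ (m + 4 + 1) / (m + 4 + 1).factorial
        = (3 / 2 : ℝ) ^ (m + 4) / (m + 4).factorial * ((3 / 2) / (m + 5)) := by
      rw [Nat.factorial_succ, pow_succ]
      push_cast
      field_simp
      ring
    have hratio : (3 / 2 : ℝ) / (m + 5) ≤ 1 / 2 := by
      rw [div_le_div_iff₀ (by positivity) (by norm_num)]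
      have : (0 : ℝ) ≤ m := m.cast_nonneg
      linarith
    rw [hstep]
    nlinarith [mul_le_mul_of_nonneg_left hratio hu]

lemma sum_exp_tail_le_half (n : ℕ) :
    ∑ k ∈ Finset.range n, (if 4 ≤ k then (3 / 2 : ℝ) ^ k / k.factorial else 0) ≤ 1 / 2 := by
  have hmono : ∑ k ∈ Finset.range n, (if 4 ≤ k then (3 / 2 : ℝ) ^ k / k.factorial else 0)
      ≤ ∑ k ∈ Finset.range (n + 4), (if 4 ≤ k then (3 / 2 : ℝ) ^ k / k.factorial else 0) := by
    refine Finset.sum_le_sum_of_subset_of_nonneg (Finset.range_mono (by omega)) ?_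
    intro k _ _
    split_ifs <;> positivity
  have hpos : (0 : ℝ) ≤ (3 / 2 : ℝ) ^ (n + 4) / (n + 4).factorial := by positivity
  linarith [sum_exp_tail_le n]

/-- A sequence with `a (n + 1) = a n - ∑ e k * a (n + 1 - k)`, where `e` is dominated by the tail
of the exponential series, decays at most geometrically with ratio `2 / 3`. -/
lemma nonneg_and_le_of_recurrence {a e : ℕ → ℝ} (h0 : 0 ≤ a 0)
    (he0 : ∀ k, 0 ≤ e k) (he : ∀ k, e k ≤ if 4 ≤ k then (1 : ℝ) / k.factorial else 0)
    (hrec : ∀ n, a (n + 1) = a n - ∑ k ∈ Finset.range (n + 2), e k * a (n + 1 - k)) (n : ℕ) :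
    0 ≤ a n ∧ ∀ j ≤ n, a j ≤ (3 / 2 : ℝ) ^ (n - j) * a n := by
  induction n with
  | zero =>
    refine ⟨h0, fun j hj => ?_⟩
    obtain rfl : j = 0 := by omega
    simp
  | succ n ih =>
    obtain ⟨hn, hle⟩ := ih
    have hsum : ∑ k ∈ Finset.range (n + 2), e k * a (n + 1 - k)
        ≤ ∑ k ∈ Finset.range (n + 2),
          (if 4 ≤ k then (3 / 2 : ℝ) ^ k / k.factorial else 0) * (2 / 3 * a n) := by
      refine Finset.sum_le_sum fun k hk => ?_
      have hk' := Finset.mem_range.mp hk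
      have hek := he k
      split_ifs at hek ⊢ with h4
      · have ha : a (n + 1 - k) ≤ (3 / 2 : ℝ) ^ (k - 1) * a n := by
          have := hle (n + 1 - k) (by omega)
          rwa [show n - (n + 1 - k) = k - 1 by omega] at this
        calc e k * a (n + 1 - k) ≤ e k * ((3 / 2 : ℝ) ^ (k - 1) * a n) :=
              mul_le_mul_of_nonneg_left ha (he0 k)
          _ ≤ 1 / k.factorial * ((3 / 2 : ℝ) ^ (k - 1) * a n) :=
              mul_le_mul_of_nonneg_right hek (by positivity)
          _ = (3 / 2 : ℝ) ^ k / k.factorial * (2 / 3 * a n) := by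
              obtain ⟨i, rfl⟩ : ∃ i, k = i + 1 := ⟨k - 1, by omega⟩
              rw [Nat.add_sub_cancel, pow_succ]
              ring
      · rw [le_antisymm hek (he0 k)]
        simp
    rw [← Finset.sum_mul] at hsum
    have htail := mul_le_mul_of_nonneg_right (sum_exp_tail_le_half (n + 2))
      (show 0 ≤ 2 / 3 * a n by positivity)
    have hstep : a n ≤ 3 / 2 * a (n + 1) := by linarith [hrec n]
    refine ⟨by linarith, fun j hj => ?_⟩
    rcases hj.eq_or_lt with rfl | hj
    · simp
    · calc a j ≤ (3 / 2 : ℝ) ^ (n - j) * a n := hle j (by omega)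
        _ ≤ (3 / 2 : ℝ) ^ (n - j) * (3 / 2 * a (n + 1)) := by gcongr
        _ = (3 / 2 : ℝ) ^ (n + 1 - j) * a (n + 1) := by
            rw [show n + 1 - j = (n - j) + 1 by omega, pow_succ]
            ring

/-- The reciprocal of `f(x) = 1 - x + ∑_{k even, k ≥ 4} x^k/k!` in `ℝ[[x]]`
has all coefficients nonnegative. -/
theorem stmt6 :
    ∀ n, 0 ≤ PowerSeries.coeff (R := ℝ) n
      (PowerSeries.mk fun k =>
          (if k = 0 then (1 : ℝ) else 0)
          - (if k = 1 then (1 : ℝ) else 0)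
          + (if Even k ∧ 4 ≤ k then (1 : ℝ) / k.factorial else 0))⁻¹ := by
  set f : PowerSeries ℝ := PowerSeries.mk fun k =>
          (if k = 0 then (1 : ℝ) else 0)
          - (if k = 1 then (1 : ℝ) else 0)
          + (if Even k ∧ 4 ≤ k then (1 : ℝ) / k.factorial else 0) with hf
  have hf0 : PowerSeries.constantCoeff f = 1 := by
    rw [← PowerSeries.coeff_zero_eq_constantCoeff_apply, hf, PowerSeries.coeff_mk]
    norm_num
  have hmul : f * f⁻¹ = 1 := PowerSeries.mul_inv_cancel f (by rw [hf0]; exact one_ne_zero)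
  refine fun n => (nonneg_and_le_of_recurrence (a := fun n => PowerSeries.coeff n f⁻¹)
    (e := fun k => if Even k ∧ 4 ≤ k then (1 : ℝ) / k.factorial else 0)
    ?_ (fun k => ?_) (fun k => ?_) (fun n => ?_) n).1
  · simp [hf0]
  · split_ifs <;> positivity
  · by_cases h4 : 4 ≤ k <;> by_cases hk : Even k <;> simp [h4, hk]
  · have h := congrArg (PowerSeries.coeff (n + 1)) hmul
    rw [PowerSeries.coeff_mul, Finset.Nat.sum_antidiagonal_eq_sum_range_succ
      (fun i j => PowerSeries.coeff i f * PowerSeries.coeff j f⁻¹)] at h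
    simp only [hf, PowerSeries.coeff_mk, add_mul, sub_mul, Finset.sum_add_distrib,
      Finset.sum_sub_distrib, ite_mul _ (1 : ℝ), one_mul, zero_mul, Finset.sum_ite_eq',
      PowerSeries.coeff_one] at h
    simp only [← hf] at h
    simp at h ⊢
    linarith
end

section
/- Let f(x) = 1 - x + x^2/2! - x^3/3! + Σ_{k even, k≥6} x^k/k!, a formal power series over ℝ. Then every coefficient of the reciprocal power series 1/f(x) is nonnegative. -/
namespace PowerSeries

theorem coeff_mul_nonneg_s7 {φ ψ : PowerSeries ℝ} (hφ : ∀ n, 0 ≤ coeff n φ)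
    (hψ : ∀ n, 0 ≤ coeff n ψ) (n : ℕ) : 0 ≤ coeff n (φ * ψ) := by
  rw [coeff_mul]
  exact Finset.sum_nonneg fun p _ => mul_nonneg (hφ p.1) (hψ p.2)

/-- A power series `1 - q₁ x - q₂ x² - ⋯` with all `qₙ ≥ 0` has a reciprocal with nonnegative
coefficients. -/
theorem coeff_inv_nonneg {φ : PowerSeries ℝ} (h0 : coeff 0 φ = 1)
    (hφ : ∀ n, coeff (n + 1) φ ≤ 0) (n : ℕ) : 0 ≤ coeff n φ⁻¹ := by
  have hc : constantCoeff φ = 1 := by simpa using h0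
  induction n using Nat.strong_induction_on with
  | _ n ih =>
    rw [coeff_inv, hc]
    split_ifs with hn
    · norm_num
    · rw [inv_one, neg_one_mul, neg_nonneg]
      refine Finset.sum_nonpos fun p hp => ?_
      split_ifs with hlt
      · have hp' := Finset.HasAntidiagonal.mem_antidiagonal.mp hp
        obtain ⟨k, hk⟩ : ∃ k, p.1 = k + 1 := ⟨p.1 - 1, by omega⟩
        rw [hk]
        exact mul_nonpos_of_nonpos_of_nonneg (hφ k) (ih _ hlt)
      · exact le_rfl

end PowerSeries

open PowerSeries

/-- The coefficients of `1 - x + x²/2! - x³/3! + ∑_{k even, k ≥ 6} x^k/k!`. -/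
noncomputable def truncExpCoeff (k : ℕ) : ℝ :=
  (if k ≤ 3 then (-1 : ℝ) ^ k / k.factorial else 0)
    + (if Even k ∧ 6 ≤ k then (1 : ℝ) / k.factorial else 0)

theorem truncExpCoeff_even {k : ℕ} (hk : Even k) (h : 6 ≤ k) :
    truncExpCoeff k = 1 / k.factorial := by
  simp [truncExpCoeff, hk, h, show ¬ k ≤ 3 by omega]

theorem truncExpCoeff_odd {k : ℕ} (hk : ¬ Even k) (h : 6 ≤ k) : truncExpCoeff k = 0 := by
  simp [truncExpCoeff, hk, show ¬ k ≤ 3 by omega]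

/-- The polynomial `1 + 2x/3 + x²/6`. -/
noncomputable def multiplierNum : PowerSeries ℝ :=
  1 + C (2 / 3 : ℝ) * X + C (1 / 6 : ℝ) * (X * X)

/-- The multiplier `(1 + 2x/3 + x²/6) / (1 - x/3)`. -/
noncomputable def multiplier : PowerSeries ℝ :=
  multiplierNum * mk fun n => (1 / 3 : ℝ) ^ n

theorem coeff_multiplier_nonneg (n : ℕ) : 0 ≤ coeff n multiplier := by
  refine coeff_mul_nonneg_s7 (fun n => ?_) (fun n => ?_) n
  · rw [multiplierNum, map_add, map_add, coeff_C_mul, coeff_C_mul, ← pow_two, coeff_X_pow,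
      coeff_X, coeff_one]
    positivity
  · rw [coeff_mk]
    positivity

theorem multiplier_mul_eq : multiplier * (1 - C (1 / 3 : ℝ) * X) = multiplierNum := by
  have h : (mk fun n => (1 / 3 : ℝ) ^ n) * (1 - C (1 / 3 : ℝ) * X) = 1 := by
    ext n
    rw [mul_sub, mul_one, mul_left_comm, map_sub, coeff_C_mul]
    cases n with
    | zero => simp
    | succ n => simp [coeff_one, pow_succ, mul_comm]
  rw [multiplier, mul_assoc, h, mul_one]

theorem constantCoeff_multiplier : constantCoeff multiplier = 1 := by
  simp [multiplier, multiplierNum]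

theorem mk_mul_multiplier_mul :
    mk truncExpCoeff * multiplier * (1 - C (1 / 3 : ℝ) * X)
      = mk truncExpCoeff + C (2 / 3 : ℝ) * (mk truncExpCoeff * X)
        + C (1 / 6 : ℝ) * (mk truncExpCoeff * X * X) := by
  rw [mul_assoc, multiplier_mul_eq, multiplierNum]
  ring

theorem coeff_zero_mk_mul_multiplier :
    coeff 0 (mk truncExpCoeff * multiplier) = 1 := by
  rw [coeff_zero_eq_constantCoeff_apply, map_mul, constantCoeff_multiplier,
    ← coeff_zero_eq_constantCoeff_apply, coeff_mk]
  simp [truncExpCoeff]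

theorem coeff_one_mk_mul_multiplier :
    coeff 1 (mk truncExpCoeff * multiplier)
      = coeff 0 (mk truncExpCoeff * multiplier) / 3 + truncExpCoeff 1
        + 2 / 3 * truncExpCoeff 0 := by
  have h := congrArg (coeff 1) mk_mul_multiplier_mul
  rw [mul_sub, mul_one, mul_left_comm, map_sub, map_add, map_add, coeff_C_mul, coeff_C_mul,
    coeff_C_mul, coeff_succ_mul_X, coeff_succ_mul_X, coeff_succ_mul_X, coeff_zero_mul_X,
    coeff_mk, coeff_mk] at h
  linarith

theorem coeff_add_two_mk_mul_multiplier (n : ℕ) :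
    coeff (n + 2) (mk truncExpCoeff * multiplier)
      = coeff (n + 1) (mk truncExpCoeff * multiplier) / 3 + truncExpCoeff (n + 2)
        + 2 / 3 * truncExpCoeff (n + 1) + truncExpCoeff n / 6 := by
  have h := congrArg (coeff (n + 2)) mk_mul_multiplier_mul
  rw [mul_sub, mul_one, mul_left_comm, map_sub, map_add, map_add, coeff_C_mul, coeff_C_mul,
    coeff_C_mul, coeff_succ_mul_X, coeff_succ_mul_X, coeff_succ_mul_X, coeff_succ_mul_X,
    coeff_mk, coeff_mk, coeff_mk] at h
  linarith

theorem truncExpCoeff_combination_le {n : ℕ} (hn : 7 ≤ n) :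
    truncExpCoeff (n + 2) + 2 / 3 * truncExpCoeff (n + 1) + truncExpCoeff n / 6
      ≤ 1 / (3 * n.factorial) - 1 / (n + 1).factorial := by
  have hf : (0 : ℝ) < n.factorial := by positivity
  have hn' : (7 : ℝ) ≤ n := by exact_mod_cast hn
  by_cases he : Even n
  · rw [truncExpCoeff_even (by simpa [Nat.even_add] using he) (by omega),
      truncExpCoeff_odd (by simpa [Nat.even_add_one] using he) (by omega),
      truncExpCoeff_even he (by omega)]
    simp only [Nat.factorial_succ]
    push_cast
    field_simp
    nlinarith
  · rw [truncExpCoeff_odd (by simpa [Nat.even_add] using he) (by omega),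
      truncExpCoeff_even (by simpa [Nat.even_add_one] using he) (by omega),
      truncExpCoeff_odd he (by omega)]
    simp only [Nat.factorial_succ]
    push_cast
    field_simp
    nlinarith

theorem coeff_mk_mul_multiplier_le {n : ℕ} (hn : 7 ≤ n)
    (h8 : coeff 8 (mk truncExpCoeff * multiplier) ≤ -(1 / (Nat.factorial 7 : ℝ))) :
    coeff (n + 1) (mk truncExpCoeff * multiplier) ≤ -(1 / (n.factorial : ℝ)) := by
  induction n, hn using Nat.le_induction with
  | base => exact h8
  | succ n hn ih =>
    rw [coeff_add_two_mk_mul_multiplier]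
    have h := truncExpCoeff_combination_le hn
    have h3 : 1 / (3 * n.factorial : ℝ) = 1 / n.factorial / 3 := by
      rw [div_div, mul_comm]
    linarith

theorem coeff_succ_mk_mul_multiplier_nonpos (n : ℕ) :
    coeff (n + 1) (mk truncExpCoeff * multiplier) ≤ 0 := by
  have c0 : truncExpCoeff 0 = 1 := by simp [truncExpCoeff]
  have c1 : truncExpCoeff 1 = -1 := by simp [truncExpCoeff]
  have c2 : truncExpCoeff 2 = 1 / 2 := by norm_num [truncExpCoeff, Nat.factorial]
  have c3 : truncExpCoeff 3 = -1 / 6 := by norm_num [truncExpCoeff, Nat.factorial]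
  have c4 : truncExpCoeff 4 = 0 := by norm_num [truncExpCoeff]
  have c5 : truncExpCoeff 5 = 0 := by norm_num [truncExpCoeff]
  have c6 : truncExpCoeff 6 = 1 / 720 := by
    rw [truncExpCoeff_even (by decide) (by norm_num)]; norm_num [Nat.factorial]
  have c7 : truncExpCoeff 7 = 0 := truncExpCoeff_odd (by decide) (by norm_num)
  have c8 : truncExpCoeff 8 = 1 / 40320 := by
    rw [truncExpCoeff_even (by decide) (by norm_num)]; norm_num [Nat.factorial]
  have e1 := coeff_one_mk_mul_multiplier
  rw [coeff_zero_mk_mul_multiplier, c0, c1] at e1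
  have e2 := coeff_add_two_mk_mul_multiplier 0
  have e3 := coeff_add_two_mk_mul_multiplier 1
  have e4 := coeff_add_two_mk_mul_multiplier 2
  have e5 := coeff_add_two_mk_mul_multiplier 3
  have e6 := coeff_add_two_mk_mul_multiplier 4
  have e7 := coeff_add_two_mk_mul_multiplier 5
  have e8 := coeff_add_two_mk_mul_multiplier 6
  norm_num only [c0, c1, c2, c3, c4, c5, c6, c7, c8] at e1 e2 e3 e4 e5 e6 e7 e8
  rcases le_or_gt 7 n with hn | hn
  · refine (coeff_mk_mul_multiplier_le hn ?_).trans (by simp)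
    norm_num [Nat.factorial]
    linarith
  · interval_cases n <;> norm_num only <;> linarith

/-- The reciprocal of
`f(x) = 1 - x + x²/2! - x³/3! + ∑_{k even, k ≥ 6} x^k/k!` in `ℝ[[x]]`
has all coefficients nonnegative. -/
theorem stmt7 :
    ∀ n, 0 ≤ PowerSeries.coeff (R := ℝ) n
      (PowerSeries.mk fun k =>
          (if k ≤ 3 then (-1 : ℝ) ^ k / k.factorial else 0)
          + (if Even k ∧ 6 ≤ k then (1 : ℝ) / k.factorial else 0))⁻¹ := by
  change ∀ n, 0 ≤ coeff n (mk truncExpCoeff)⁻¹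
  have h : (mk truncExpCoeff)⁻¹ = multiplier * (mk truncExpCoeff * multiplier)⁻¹ := by
    rw [PowerSeries.mul_inv_rev, ← mul_assoc,
      PowerSeries.mul_inv_cancel _ (by simp [constantCoeff_multiplier]), one_mul]
  rw [h]
  exact coeff_mul_nonneg_s7 coeff_multiplier_nonneg
    (coeff_inv_nonneg coeff_zero_mk_mul_multiplier coeff_succ_mk_mul_multiplier_nonpos)
end

section
/- Let m be a positive integer. Define (c_n) by (Σ_{k=0}^{2m-1} (-1)^k x^k/k!)^{-1} = Σ_{n≥0} c_n x^n/n! in ℚ[[x]]. Then for every n ≥ 0, c_n equals the number of permutations of {1, ..., n} in which every maximal increasing run has length congruent to 0 or 1 modulo 2m. -/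
/-- The list of lengths of the maximal increasing runs (read left to right) of the word
`σ(1) σ(2) ⋯ σ(n)` associated to a permutation `σ` of `{1, ..., n}`. -/
def runLengths {n : ℕ} (σ : Equiv.Perm (Fin n)) : List ℕ :=
  ((List.ofFn fun i => σ i).splitBy fun a b => decide (a < b)).map List.length

namespace RunCount

open Finset

variable {α β : Type*} [LinearOrder α] [LinearOrder β]

/-- All maximal increasing runs of the word `l` have a length satisfying `P`. -/
def AllRuns (P : ℕ → Prop) (l : List α) : Prop :=
  ∀ r ∈ l.splitBy (fun a b => decide (a < b)), P r.length

/-- The words using each letter of `S` exactly once. -/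
def words (S : Finset α) : Finset (List α) := (Multiset.lists S.val).toFinset

theorem mem_words {S : Finset α} {l : List α} : l ∈ words S ↔ l.Nodup ∧ l.toFinset = S := by
  simp only [words, Multiset.mem_toFinset, Multiset.mem_lists_iff, Multiset.quot_mk_to_coe]
  constructor
  · intro h
    have hn : l.Nodup := by
      have := S.nodup
      rwa [h, Multiset.coe_nodup] at this
    exact ⟨hn, Finset.val_injective (by rw [List.toFinset_val, hn.dedup, h])⟩
  · rintro ⟨hn, rfl⟩
    rw [List.toFinset_val, hn.dedup]

theorem length_of_mem_words {S : Finset α} {l : List α} (h : l ∈ words S) :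
    l.length = #S := by
  obtain ⟨hn, rfl⟩ := mem_words.1 h
  exact (List.toFinset_card_of_nodup hn).symm

theorem splitBy_map_strictMono {f : α → β} (hf : StrictMono f) (l : List α) :
    (l.map f).splitBy (fun a b => decide (a < b)) =
      (l.splitBy (fun a b => decide (a < b))).map (List.map f) := by
  obtain ⟨h₁, h₂, h₃, h₄⟩ := List.splitBy_eq_iff.1
    (rfl : l.splitBy (fun a b => decide (a < b)) = _)
  refine List.splitBy_eq_iff.2 ⟨?_, ?_, ?_, ?_⟩
  · rw [← List.map_flatten, ← h₁]
  · simp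
  · simp only [List.mem_map, forall_exists_index, and_imp, forall_apply_eq_imp_iff₂]
    intro r hr
    simpa [List.isChain_map, hf.lt_iff_lt] using h₃ r hr
  · rw [List.isChain_map]
    refine h₄.imp fun a b => ?_
    rintro ⟨ha, hb, h⟩
    exact ⟨by simpa using ha, by simpa using hb, by simpa [hf.le_iff_le] using h⟩

theorem allRuns_map {P : ℕ → Prop} {f : α → β} (hf : StrictMono f) (l : List α) :
    AllRuns P (l.map f) ↔ AllRuns P l := by
  simp [AllRuns, splitBy_map_strictMono hf]

theorem allRuns_append {P : ℕ → Prop} {r t : List α} (hr : r.IsChain (· < ·)) (hne : r ≠ [])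
    (h : ∀ x ∈ r.getLast?, ∀ y ∈ t.head?, ¬ x < y) :
    AllRuns P (r ++ t) ↔ P r.length ∧ AllRuns P t := by
  rw [AllRuns, List.splitBy_append (by simpa using h),
    List.splitBy_of_isChain hne (by simpa using hr)]
  simp [AllRuns]

theorem exists_first_run (l : List α) (hl : l ≠ []) :
    ∃ r t, l = r ++ t ∧ r ≠ [] ∧ r.IsChain (· < ·) ∧
      ∀ x ∈ r.getLast?, ∀ y ∈ t.head?, ¬ x < y := by
  induction l with
  | nil => exact absurd rfl hl
  | cons a l ih =>
    rcases l with _ | ⟨b, l⟩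
    · exact ⟨[a], [], by simp⟩
    · by_cases hab : a < b
      · obtain ⟨r, t, h, hr, hc, hb⟩ := ih (by simp)
        rcases r with _ | ⟨b', r⟩
        · exact absurd rfl hr
        · obtain ⟨rfl, h⟩ : b = b' ∧ l = r ++ t := by simpa using h
          exact ⟨a :: b :: r, t, by simp [h], by simp, by simp [hab, hc], by simpa using hb⟩
      · exact ⟨[a], b :: l, by simp, by simp, by simp, by simpa using hab⟩

theorem isChain_take_iff {r t : List α} (hr : r.IsChain (· < ·)) (hne : r ≠ [])
    (h : ∀ x ∈ r.getLast?, ∀ y ∈ t.head?, ¬ x < y) {k : ℕ} (hk : k ≤ (r ++ t).length) :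
    ((r ++ t).take k).IsChain (· < ·) ↔ k ≤ r.length := by
  constructor
  · intro hc
    by_contra! hlt
    rw [List.take_append, List.take_of_length_le hlt.le, List.isChain_append] at hc
    rcases t with _ | ⟨y, t⟩
    · simp at hk; omega
    · obtain ⟨j, hj⟩ : ∃ j, k - r.length = j + 1 := ⟨k - r.length - 1, by omega⟩
      rw [hj] at hc
      exact h _ (List.getLast_mem_getLast? hne) y (by simp)
        (hc.2.2 _ (List.getLast_mem_getLast? hne) y (by simp))
  · intro hle
    rw [List.take_append_of_le_length hle]
    exact hr.take k

theorem allRuns_drop_iff {P : ℕ → Prop} {r t : List α} (h0 : P 0) (hr : r.IsChain (· < ·))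
    (h : ∀ x ∈ r.getLast?, ∀ y ∈ t.head?, ¬ x < y) {k : ℕ} (hk : k ≤ r.length) :
    AllRuns P ((r ++ t).drop k) ↔ P (r.length - k) ∧ AllRuns P t := by
  rw [List.drop_append_of_le_length hk]
  rcases hk.eq_or_lt with rfl | hlt
  · simp [h0]
  · have hne : r.drop k ≠ [] := by simpa using hlt
    rw [allRuns_append (hr.drop k) hne, List.length_drop]
    intro x hx
    refine h x ?_
    rw [List.getLast?_drop, if_neg (by omega)] at hx
    exact hx

theorem mod_sub_iff {q L k : ℕ} (hq : 2 ≤ q) (hL : 1 ≤ L) (hk : k < q) :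
    (k ≤ L ∧ ((L - k) % q = 0 ∨ (L - k) % q = 1)) ↔
      k = L % q ∨ k = (if L % q = 0 then q - 1 else L % q - 1) := by
  have hr : L % q < q := Nat.mod_lt _ (by omega)
  have hdiv := Nat.mod_add_div L q
  rcases Nat.eq_zero_or_pos (L / q) with hd | hd
  · have hLq : L % q = L := by rw [hd] at hdiv; omega
    rw [hLq] at hr ⊢
    rw [if_neg (by omega), Nat.mod_eq_of_lt (by omega)]
    omega
  · obtain ⟨d, hd'⟩ : ∃ d, L / q = d + 1 := ⟨L / q - 1, by omega⟩
    rw [hd', mul_add, mul_one] at hdiv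
    generalize L % q = r at *
    generalize hz : q * d = z at *
    by_cases hkr : k ≤ r
    · have e : L - k = q * (d + 1) + (r - k) := by rw [mul_add]; omega
      rw [e, Nat.mul_add_mod, Nat.mod_eq_of_lt (by omega)]
      split_ifs <;> omega
    · have e : L - k = q * d + (q + r - k) := by omega
      rw [e, Nat.mul_add_mod, Nat.mod_eq_of_lt (by omega)]
      split_ifs <;> omega

open Classical in
/-- The number of words on the letters `S` all of whose runs have a length satisfying `P`. -/
noncomputable def runCount (P : ℕ → Prop) (S : Finset α) : ℕ := #{l ∈ words S | AllRuns P l}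

open Classical in
theorem sum_sign_eq_zero {m : ℕ} (hm : 1 ≤ m) {l : List α} (hl : l ≠ []) :
    ∑ k ∈ range (l.length + 1) with k < 2 * m ∧ (l.take k).IsChain (· < ·) ∧
      AllRuns (fun i => i % (2 * m) = 0 ∨ i % (2 * m) = 1) (l.drop k), (-1 : ℚ) ^ k = 0 := by
  obtain ⟨r, t, rfl, hne, hc, hb⟩ := exists_first_run l hl
  have hL : 1 ≤ r.length := List.length_pos_iff.2 hne
  set P : ℕ → Prop := fun i => i % (2 * m) = 0 ∨ i % (2 * m) = 1 with hP
  have key : ∀ k, (k ∈ range ((r ++ t).length + 1) ∧ k < 2 * m ∧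
      ((r ++ t).take k).IsChain (· < ·) ∧ AllRuns P ((r ++ t).drop k)) ↔
      (k < 2 * m ∧ k ≤ r.length ∧ P (r.length - k)) ∧ AllRuns P t := by
    intro k
    rw [mem_range, Nat.lt_succ_iff]
    constructor
    · rintro ⟨h₁, h₂, h₃, h₄⟩
      rw [isChain_take_iff hc hne hb h₁] at h₃
      rw [allRuns_drop_iff (by simp [hP]) hc hb h₃] at h₄
      exact ⟨⟨h₂, h₃, h₄.1⟩, h₄.2⟩
    · rintro ⟨⟨h₂, h₃, h₄⟩, h₅⟩
      have h₁ : k ≤ (r ++ t).length := by rw [List.length_append]; omega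
      exact ⟨h₁, h₂, (isChain_take_iff hc hne hb h₁).2 h₃,
        (allRuns_drop_iff (by simp [hP]) hc hb h₃).2 ⟨h₄, h₅⟩⟩
  by_cases ht : AllRuns P t
  · set p := r.length % (2 * m) with hp
    set p' := if r.length % (2 * m) = 0 then 2 * m - 1 else r.length % (2 * m) - 1 with hp'
    have hlt : p < 2 * m := Nat.mod_lt _ (by omega)
    have hlt' : p' < 2 * m := by rw [hp']; split_ifs <;> omega
    have hpp : p ≠ p' := by rw [hp']; split_ifs <;> omega
    have hset : (range ((r ++ t).length + 1)).filter (fun k => k < 2 * m ∧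
        ((r ++ t).take k).IsChain (· < ·) ∧ AllRuns P ((r ++ t).drop k)) = {p, p'} := by
      ext k
      rw [mem_filter, key, mem_insert, mem_singleton]
      constructor
      · rintro ⟨⟨h₁, h₂⟩, -⟩
        exact (mod_sub_iff (by omega) hL h₁).1 h₂
      · intro h
        have h₁ : k < 2 * m := by rcases h with rfl | rfl <;> assumption
        exact ⟨⟨h₁, (mod_sub_iff (by omega) hL h₁).2 h⟩, ht⟩
    rw [hset, sum_pair hpp]
    rw [hp']
    split_ifs with h0
    · have hodd : Odd (2 * m - 1) := ⟨m - 1, by omega⟩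
      rw [hp, h0, hodd.neg_one_pow]; simp
    · obtain ⟨j, hj⟩ : ∃ j, p = j + 1 := ⟨p - 1, by omega⟩
      rw [← hp, hj, pow_succ, Nat.add_sub_cancel]; ring
  · refine sum_eq_zero fun k hk => ?_
    rw [mem_filter, key] at hk
    exact absurd hk.2 ht

theorem card_perm_eq_runCount (P : ℕ → Prop) {n : ℕ} (S : Finset α) (hS : #S = n) :
    Nat.card {σ : Equiv.Perm (Fin n) // ∀ l ∈ runLengths σ, P l} = runCount P S := by
  classical
  have hmono := (S.orderEmbOfFin hS).strictMono
  have hrun : ∀ σ : Equiv.Perm (Fin n), (∀ l ∈ runLengths σ, P l) ↔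
      AllRuns P (List.ofFn fun i => S.orderEmbOfFin hS (σ i)) := by
    intro σ
    have : (List.ofFn fun i => S.orderEmbOfFin hS (σ i)) =
        (List.ofFn fun i => σ i).map (S.orderEmbOfFin hS) := by
      rw [List.map_ofFn]; rfl
    rw [this, allRuns_map hmono]
    simp [runLengths, AllRuns]
  rw [Nat.card_eq_fintype_card, Fintype.card_subtype, runCount]
  refine card_bij (fun σ _ => List.ofFn fun i => S.orderEmbOfFin hS (σ i)) ?_ ?_ ?_
  · intro σ hσ
    rw [mem_filter] at hσ ⊢
    refine ⟨mem_words.2 ⟨?_, ?_⟩, (hrun σ).1 hσ.2⟩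
    · exact List.nodup_ofFn.2 (hmono.injective.comp σ.injective)
    · ext x
      rw [List.mem_toFinset, List.mem_ofFn', ← Finset.mem_coe, ← S.range_orderEmbOfFin hS]
      exact iff_of_eq (congrArg (x ∈ ·) (σ.surjective.range_comp (S.orderEmbOfFin hS)))
  · intro σ _ τ _ h
    have := List.ofFn_injective h
    ext i
    exact congrArg Fin.val (hmono.injective (congrFun this i))
  · intro l hl
    rw [mem_filter] at hl
    obtain ⟨hn, ht⟩ := mem_words.1 hl.1
    have hlen : l.length = n := (length_of_mem_words hl.1).trans hS
    subst hlen
    have hmem : ∀ i : Fin l.length, l.get i ∈ S := fun i => by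
      rw [← ht, List.mem_toFinset]; exact List.get_mem l i
    let f : Fin l.length → Fin l.length := fun i => (S.orderIsoOfFin hS).symm ⟨l.get i, hmem i⟩
    have hf : Function.Injective f := by
      intro i j hij
      have := (S.orderIsoOfFin hS).symm.injective hij
      exact List.nodup_iff_injective_get.1 hn (congrArg Subtype.val this)
    let σ : Equiv.Perm (Fin l.length) :=
      Equiv.ofBijective f (Finite.injective_iff_bijective.1 hf)
    have hσ : (List.ofFn fun i => S.orderEmbOfFin hS (σ i)) = l := by
      conv_rhs => rw [← List.ofFn_get l]
      congr 1
      ext i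
      rw [← coe_orderIsoOfFin_apply]
      simp [σ, f]
    refine ⟨σ, ?_, hσ⟩
    rw [mem_filter]
    exact ⟨mem_univ _, (hrun σ).2 (by rw [hσ]; exact hl.2)⟩

open Classical in
theorem card_increasing_prefix (P : ℕ → Prop) (S : Finset α) {k : ℕ} (hk : k ≤ #S) :
    #{l ∈ words S | (l.take k).IsChain (· < ·) ∧ AllRuns P (l.drop k)} =
      ∑ T ∈ S.powersetCard k, runCount P (S \ T) := by
  simp only [runCount]
  rw [← card_sigma]
  refine card_bij' (fun l _ => ⟨(l.take k).toFinset, l.drop k⟩) (fun x _ => x.1.sort ++ x.2)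
    ?_ ?_ ?_ ?_
  · intro l hl
    rw [mem_filter] at hl
    have hlen := length_of_mem_words hl.1
    obtain ⟨hn, rfl⟩ := mem_words.1 hl.1
    have hn' := hn
    rw [← List.take_append_drop k l, List.nodup_append'] at hn'
    have hu : l.toFinset = (l.take k).toFinset ∪ (l.drop k).toFinset := by
      rw [← List.toFinset_append, List.take_append_drop]
    have hd : Disjoint (l.drop k).toFinset (l.take k).toFinset :=
      List.disjoint_toFinset_iff_disjoint.2 hn'.2.2.symm
    rw [mem_sigma, mem_filter, mem_powersetCard, mem_words]
    refine ⟨⟨?_, ?_⟩, ⟨hn'.2.1, ?_⟩, hl.2.2⟩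
    · rw [hu]; exact subset_union_left
    · rw [List.toFinset_card_of_nodup hn'.1, List.length_take]; omega
    · rw [hu, union_sdiff_left, sdiff_eq_self_of_disjoint hd]
  · rintro ⟨T, u⟩ hx
    rw [mem_sigma, mem_filter, mem_powersetCard, mem_words] at hx
    obtain ⟨⟨hT, rfl⟩, ⟨hu, hu'⟩, hg⟩ := hx
    dsimp only at *
    rw [mem_filter, mem_words]
    refine ⟨⟨?_, ?_⟩, ?_, ?_⟩
    · rw [List.nodup_append']
      refine ⟨sort_nodup _ _, hu, ?_⟩
      rw [← List.disjoint_toFinset_iff_disjoint, sort_toFinset, hu']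
      exact disjoint_sdiff
    · rw [List.toFinset_append, sort_toFinset, hu', union_sdiff_of_subset hT]
    · rw [List.take_left' (length_sort _)]
      exact List.sortedLT_iff_isChain.1 (sortedLT_sort T)
    · rwa [List.drop_left' (length_sort _)]
  · intro l hl
    rw [mem_filter] at hl
    have hs := List.sortedLT_iff_isChain.2 hl.2.1
    dsimp only
    rw [(List.toFinset_sort _ hs.nodup).2 hs.sortedLE.pairwise, List.take_append_drop]
  · rintro ⟨T, u⟩ hx
    rw [mem_sigma, mem_powersetCard] at hx
    obtain ⟨⟨hT, rfl⟩, -⟩ := hx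
    dsimp only at *
    rw [List.take_left' (length_sort _), List.drop_left' (length_sort _), sort_toFinset]

theorem sum_choose_mul_card_eq_zero {m : ℕ} (hm : 1 ≤ m) {a : ℕ → ℕ}
    (ha : ∀ n, a n = Nat.card {σ : Equiv.Perm (Fin n) //
      ∀ l ∈ runLengths σ, l % (2 * m) = 0 ∨ l % (2 * m) = 1}) {n : ℕ} (hn : n ≠ 0) :
    ∑ k ∈ range (n + 1), (if k < 2 * m then (-1 : ℚ) ^ k else 0) *
      (n.choose k * a (n - k)) = 0 := by
  classical
  set P : ℕ → Prop := fun i => i % (2 * m) = 0 ∨ i % (2 * m) = 1 with hP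
  have hcard : ∀ k ∈ range (n + 1), (n.choose k * a (n - k) : ℚ) =
      ∑ l ∈ words (univ : Finset (Fin n)),
        if (l.take k).IsChain (· < ·) ∧ AllRuns P (l.drop k) then 1 else 0 := by
    intro k hk
    rw [mem_range, Nat.lt_succ_iff] at hk
    rw [sum_boole, card_increasing_prefix P univ (by simpa using hk),
      sum_congr rfl (g := fun _ => a (n - k)) ?_]
    · simp
    · intro T hT
      rw [mem_powersetCard] at hT
      rw [ha, card_perm_eq_runCount P (univ \ T)]
      rw [card_sdiff_of_subset hT.1, hT.2, card_univ, Fintype.card_fin]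
  rw [sum_congr rfl fun k hk => by rw [hcard k hk, mul_sum]]
  rw [sum_comm]
  refine sum_eq_zero fun l hl => ?_
  have hlen : l.length = n := by simpa using length_of_mem_words hl
  have := sum_sign_eq_zero hm (l := l) (by rintro rfl; exact hn hlen.symm)
  rw [sum_filter, hlen] at this
  refine (sum_congr rfl fun k _ => ?_).trans this
  by_cases h₁ : k < 2 * m <;> simp [h₁, hP]

end RunCount

/-- Gessel. For `m ≥ 1`, the coefficients `c n` of the reciprocal of
`∑_{k=0}^{2m-1} (-1)^k x^k/k!`, written as `∑ cₙ xⁿ/n!`, count the permutations of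
`{1, ..., n}` in which every maximal increasing run has length `≡ 0` or `1 (mod 2m)`. -/
theorem stmt12 (m : ℕ) (hm : 1 ≤ m) (c : ℕ → ℚ)
    (hc : (∑ k ∈ Finset.range (2 * m),
          PowerSeries.monomial (R := ℚ) k ((-1 : ℚ) ^ k / k.factorial))⁻¹
        = PowerSeries.mk fun n => c n / n.factorial) :
    ∀ n, c n = (Nat.card {σ : Equiv.Perm (Fin n) //
        ∀ l ∈ runLengths σ, l % (2 * m) = 0 ∨ l % (2 * m) = 1} : ℚ) := by
  obtain ⟨a, ha⟩ : ∃ a : ℕ → ℕ, ∀ n, a n = Nat.card {σ : Equiv.Perm (Fin n) //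
      ∀ l ∈ runLengths σ, l % (2 * m) = 0 ∨ l % (2 * m) = 1} := ⟨_, fun _ => rfl⟩
  set f := ∑ k ∈ Finset.range (2 * m),
    PowerSeries.monomial (R := ℚ) k ((-1 : ℚ) ^ k / k.factorial) with hf
  have hcoeff : ∀ k, PowerSeries.coeff k f =
      if k < 2 * m then (-1 : ℚ) ^ k / k.factorial else 0 := by
    intro k
    simp [hf, PowerSeries.coeff_monomial]
  have hf0 : PowerSeries.constantCoeff f ≠ 0 := by
    rw [← PowerSeries.coeff_zero_eq_constantCoeff_apply, hcoeff, if_pos (by omega)]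
    simp
  have ha0 : a 0 = 1 := by
    rw [ha, Nat.card_eq_one_iff_unique]
    exact ⟨inferInstance, ⟨1, by simp [runLengths]⟩⟩
  have hmul : (PowerSeries.mk fun n => (a n : ℚ) / n.factorial) * f = 1 := by
    ext n
    rw [mul_comm, PowerSeries.coeff_mul, Finset.Nat.sum_antidiagonal_eq_sum_range_succ_mk,
      PowerSeries.coeff_one]
    simp only [hcoeff, PowerSeries.coeff_mk]
    split_ifs with hn
    · subst hn
      simp [ha0, show 0 < m by omega]
    · have hz := congrArg (· / (n.factorial : ℚ))
        (RunCount.sum_choose_mul_card_eq_zero hm ha hn)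
      simp only [Finset.sum_div, zero_div] at hz
      refine (Finset.sum_congr rfl fun k hk => ?_).trans hz
      rw [Finset.mem_range, Nat.lt_succ_iff] at hk
      split_ifs
      · rw [Nat.cast_choose ℚ hk]
        have h₁ : (n.factorial : ℚ) ≠ 0 := by positivity
        field_simp
      · simp
  have heq := (PowerSeries.eq_inv_iff_mul_eq_one hf0).2 hmul
  intro n
  have h := congrArg (PowerSeries.coeff n) (heq.trans hc)
  simp only [PowerSeries.coeff_mk] at h
  rw [← ha, (div_left_inj' (by positivity : (n.factorial : ℚ) ≠ 0)).1 h]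
end

section
/- Let m, b, and r be positive integers with r ≥ 2. Define (c_n) by (Σ_{k=0}^{m-1} (x^{krb}/(krb)! - x^{(kr+1)b}/((kr+1)b)!))^{-1} = Σ_{n≥0} c_n x^n/n! in ℚ[[x]]. Then for every n ≥ 0, c_n equals the number of permutations of {1, ..., n} in which every maximal increasing run has length congruent modulo mrb to one of 0, b, 2b, ..., (r-1)b. -/
/-- The product of the weights `w` of the lengths of the maximal increasing runs of a word. -/
def runWeight {α : Type*} [LinearOrder α] (w : ℕ → ℚ) (l : List α) : ℚ :=
  ((l.splitBy fun a b => decide (a < b)).map fun t => w t.length).prod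

/-- The words in which each element of `s` occurs exactly once and nothing else occurs. -/
def arrangements {α : Type*} [DecidableEq α] (s : Finset α) : Finset (List α) :=
  (Multiset.lists s.val).toFinset

section RunWeight

variable {α : Type*} [LinearOrder α]

theorem mem_arrangements {s : Finset α} {l : List α} :
    l ∈ arrangements s ↔ l.Nodup ∧ l.toFinset = s := by
  rw [arrangements, Multiset.mem_toFinset, Multiset.mem_lists_iff]
  constructor
  · intro h
    have hn : l.Nodup := by
      have := s.nodup
      rw [h] at this
      simpa using this
    refine ⟨hn, ?_⟩
    apply Finset.val_injective
    rw [h, List.toFinset_val, hn.dedup]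
    rfl
  · rintro ⟨hn, rfl⟩
    rw [List.toFinset_val, hn.dedup]
    rfl

theorem length_of_mem_arrangements {s : Finset α} {l : List α} (h : l ∈ arrangements s) :
    l.length = s.card := by
  obtain ⟨hn, rfl⟩ := mem_arrangements.1 h
  exact (List.toFinset_card_of_nodup hn).symm

theorem runWeight_append (w : ℕ → ℚ) {l t : List α}
    (h : ∀ x ∈ l.getLast?, ∀ y ∈ t.head?, ¬ x < y) :
    runWeight w (l ++ t) = runWeight w l * runWeight w t := by
  rw [runWeight, List.splitBy_append (by simpa using h), List.map_append, List.prod_append]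
  rfl

theorem runWeight_of_isChain {w : ℕ → ℚ} (hw : w 0 = 1) {l : List α}
    (h : l.IsChain (· < ·)) : runWeight w l = w l.length := by
  rcases eq_or_ne l [] with rfl | hl
  · simp [runWeight, hw]
  · rw [runWeight, List.splitBy_of_isChain hl (by simpa using h)]
    simp

/-- Every nonempty word splits off its first maximal increasing run. -/
theorem exists_eq_run_append {l : List α} (hl : l ≠ []) :
    ∃ u t : List α, l = u ++ t ∧ u ≠ [] ∧ u.IsChain (· < ·) ∧
      ∀ x ∈ u.getLast?, ∀ y ∈ t.head?, ¬ x < y := by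
  induction l with
  | nil => exact absurd rfl hl
  | cons a l ih =>
    rcases l with _ | ⟨b, l⟩
    · exact ⟨[a], [], by simp⟩
    · by_cases hab : a < b
      · obtain ⟨u, t, h, hu, hc, hb⟩ := ih (by simp)
        rcases u with _ | ⟨c, u⟩
        · exact absurd rfl hu
        · obtain rfl : b = c := by simpa using congrArg List.head? h
          refine ⟨a :: b :: u, t, by simp [h], by simp, hc.cons_cons hab, ?_⟩
          simpa [List.getLast?_cons_cons] using hb
      · exact ⟨[a], b :: l, by simp, by simp, by simp, by simpa using hab⟩

/-- If `a` and `w` are inverse to each other under convolution, then the sum over the increasing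
prefixes of a nonempty word, weighted by `a` on the prefix and by `w` on the runs of the rest,
vanishes. -/
theorem sum_isChain_take_mul_runWeight_drop {a w : ℕ → ℚ} (hw : w 0 = 1)
    (haw : ∀ n, n ≠ 0 → ∑ k ∈ Finset.range (n + 1), a k * w (n - k) = 0)
    {l : List α} (hl : l ≠ []) :
    ∑ k ∈ Finset.range (l.length + 1),
      (if (l.take k).IsChain (· < ·) then a k * runWeight w (l.drop k) else 0) = 0 := by
  obtain ⟨u, t, rfl, hu, hc, hb⟩ := exists_eq_run_append hl
  have hsub : Finset.range (u.length + 1) ⊆ Finset.range ((u ++ t).length + 1) := by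
    apply Finset.range_subset_range.2
    simp
  rw [← Finset.sum_subset hsub]
  · rw [← mul_zero (runWeight w t), ← haw u.length (by simpa using hu), Finset.mul_sum]
    refine Finset.sum_congr rfl fun k hk => ?_
    have hk : k ≤ u.length := by simpa [Nat.lt_succ_iff] using hk
    rw [List.take_append_of_le_length hk, List.drop_append_of_le_length hk, if_pos (hc.take k),
      runWeight_append, runWeight_of_isChain hw (hc.drop k), List.length_drop]
    · ring
    · intro x hx
      apply hb
      rw [List.getLast?_drop] at hx
      split at hx <;> simp_all
  · intro k hk hk'
    rw [if_neg]
    intro h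
    have hk' : u.length < k := by simpa [Nat.lt_succ_iff] using hk'
    rw [List.take_append, List.take_of_length_le hk'.le, List.isChain_append] at h
    rcases t with _ | ⟨y, t⟩
    · simp at hk
      omega
    · obtain ⟨d, hd⟩ := Nat.exists_eq_add_of_lt hk'
      obtain ⟨x, hx⟩ : ∃ x, x ∈ u.getLast? := ⟨_, List.getLast?_eq_getLast_of_ne_nil hu⟩
      refine hb x hx y (by simp) (h.2.2 x hx y ?_)
      rw [hd, show u.length + d + 1 - u.length = d + 1 by omega]
      simp

theorem sum_powerset_mul_sum_arrangements (a : ℕ → ℚ) (f : List α → ℚ) (s : Finset α) :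
    ∑ t ∈ s.powerset, a t.card * ∑ l ∈ arrangements (s \ t), f l =
      ∑ l ∈ arrangements s, ∑ k ∈ Finset.range (s.card + 1),
        (if (l.take k).IsChain (· < ·) then a k * f (l.drop k) else 0) := by
  simp_rw [Finset.mul_sum]
  rw [← Finset.sum_product', ← Finset.sum_filter, Finset.sum_sigma']
  refine Finset.sum_bij' (fun p _ => (p.1.sort ++ p.2, p.1.card))
    (fun p _ => ⟨(p.1.take p.2).toFinset, p.1.drop p.2⟩) ?_ ?_ ?_ ?_ ?_
  · rintro ⟨t, l⟩ h
    simp only [Finset.mem_sigma, Finset.mem_powerset, mem_arrangements] at h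
    obtain ⟨ht, hn, hl⟩ := h
    simp only [Finset.mem_filter, Finset.mem_product, mem_arrangements, Finset.mem_range,
      Nat.lt_succ_iff]
    refine ⟨⟨⟨?_, ?_⟩, Finset.card_le_card ht⟩, ?_⟩
    · refine List.Nodup.append (t.sort_nodup _) hn fun x hx hx' => ?_
      rw [Finset.mem_sort] at hx
      rw [← List.mem_toFinset, hl] at hx'
      exact (Finset.mem_sdiff.1 hx').2 hx
    · rw [List.toFinset_append, Finset.sort_toFinset, hl, Finset.union_sdiff_of_subset ht]
    · rw [List.take_left' (by simp)]
      exact t.sortedLT_sort.isChain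
  · rintro ⟨l, k⟩ h
    simp only [Finset.mem_filter, Finset.mem_product, mem_arrangements] at h
    obtain ⟨⟨⟨hn, rfl⟩, -⟩, -⟩ := h
    simp only [Finset.mem_sigma, Finset.mem_powerset, mem_arrangements]
    refine ⟨fun x hx => ?_, hn.sublist (List.drop_sublist k l), ?_⟩
    · simp only [List.mem_toFinset] at hx ⊢
      exact List.mem_of_mem_take hx
    · have hd := List.disjoint_take_drop hn (le_refl k)
      conv_rhs => rw [← List.take_append_drop k l, List.toFinset_append]
      rw [List.take_append_drop, Finset.union_sdiff_cancel_left]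
      exact List.disjoint_toFinset_iff_disjoint.2 hd
  · rintro ⟨t, l⟩ h
    simp only [Sigma.mk.injEq]
    rw [List.take_left' (by simp), List.drop_left' (by simp), Finset.sort_toFinset]
    exact ⟨rfl, HEq.rfl⟩
  · rintro ⟨l, k⟩ h
    simp only [Finset.mem_filter, Finset.mem_product, Finset.mem_range, Nat.lt_succ_iff] at h
    obtain ⟨⟨hl, hk⟩, hc⟩ := h
    have hn : (l.take k).Nodup := (mem_arrangements.1 hl).1.sublist (List.take_sublist k l)
    simp only [Prod.mk.injEq]
    rw [(List.toFinset_sort (· ≤ ·) hn).2 hc.sortedLT.sortedLE.pairwise, List.take_append_drop,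
      List.toFinset_card_of_nodup hn, List.length_take, length_of_mem_arrangements hl]
    exact ⟨rfl, min_eq_left hk⟩
  · rintro ⟨t, l⟩ h
    simp only
    rw [List.drop_left' (by simp)]

/-- The run theorem: the exponential generating function of the run-weighted permutations is the
reciprocal of the exponential generating function of `a`, where `a` is the convolution inverse
of the weight sequence `w`. -/
theorem sum_arrangements_runWeight {a w c : ℕ → ℚ} (hw : w 0 = 1) (ha : a 0 = 1)
    (haw : ∀ n, n ≠ 0 → ∑ k ∈ Finset.range (n + 1), a k * w (n - k) = 0)
    (hac : ∀ n, ∑ k ∈ Finset.range (n + 1), n.choose k * (a k * c (n - k)) =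
      if n = 0 then 1 else 0) (s : Finset α) :
    ∑ l ∈ arrangements s, runWeight w l = c s.card := by
  induction s using Finset.strongInduction with
  | H s ih =>
    have h₁ : ∑ t ∈ s.powerset, a t.card * ∑ l ∈ arrangements (s \ t), runWeight w l =
        if s.card = 0 then 1 else 0 := by
      rw [sum_powerset_mul_sum_arrangements]
      split_ifs with hs
      · obtain rfl := Finset.card_eq_zero.1 hs
        have : arrangements (∅ : Finset α) = {[]} := by
          ext l
          simp +contextual [mem_arrangements]
        simp [this, ha, runWeight]
      · refine Finset.sum_eq_zero fun l hl => ?_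
        rw [← length_of_mem_arrangements hl] at hs ⊢
        exact sum_isChain_take_mul_runWeight_drop hw haw (by simpa using hs)
    have h₂ : ∑ t ∈ s.powerset, a t.card * c (s \ t).card = if s.card = 0 then 1 else 0 := by
      rw [← hac, ← (Finset.sum_congr rfl fun k _ => nsmul_eq_mul _ _),
        ← Finset.sum_powerset_apply_card fun k => a k * c (s.card - k)]
      refine Finset.sum_congr rfl fun t ht => ?_
      rw [Finset.card_sdiff_of_subset (Finset.mem_powerset.1 ht)]
    have h₃ : ∑ t ∈ s.powerset.erase ∅, a t.card * ∑ l ∈ arrangements (s \ t), runWeight w l =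
        ∑ t ∈ s.powerset.erase ∅, a t.card * c (s \ t).card := by
      refine Finset.sum_congr rfl fun t ht => ?_
      rw [Finset.mem_erase, Finset.mem_powerset] at ht
      rw [ih _ (Finset.sdiff_ssubset ht.2 (Finset.nonempty_iff_ne_empty.2 ht.1))]
    rw [← Finset.add_sum_erase _ _ (Finset.empty_mem_powerset s)] at h₁ h₂
    rw [h₃, ← h₂] at h₁
    simpa [ha] using add_right_cancel h₁

theorem runWeight_indicator (p : ℕ → Prop) [DecidablePred p] (l : List α)
    [Decidable (∀ k ∈ (l.splitBy fun a b => decide (a < b)).map List.length, p k)] :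
    runWeight (fun n => if p n then 1 else 0) l =
      if ∀ k ∈ (l.splitBy fun a b => decide (a < b)).map List.length, p k then 1 else 0 := by
  rw [runWeight]
  split_ifs with h
  · refine List.prod_eq_one fun x hx => ?_
    obtain ⟨u, hu, rfl⟩ := List.mem_map.1 hx
    exact if_pos (h _ (List.mem_map_of_mem hu))
  · push Not at h
    obtain ⟨k, hk, hpk⟩ := h
    obtain ⟨u, hu, rfl⟩ := List.mem_map.1 hk
    exact List.prod_eq_zero (List.mem_map.2 ⟨u, hu, if_neg hpk⟩)

end RunWeight

theorem sum_perm_ofFn {n : ℕ} (f : List (Fin n) → ℚ) :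
    ∑ σ : Equiv.Perm (Fin n), f (List.ofFn fun i => σ i) =
      ∑ l ∈ arrangements (Finset.univ : Finset (Fin n)), f l := by
  refine Finset.sum_bij (fun σ _ => List.ofFn fun i => σ i) ?_ ?_ ?_ ?_
  · intro σ _
    rw [mem_arrangements]
    refine ⟨List.nodup_ofFn.2 σ.injective, ?_⟩
    ext x
    simpa using ⟨σ.symm x, by simp⟩
  · intro σ _ τ _ h
    exact Equiv.ext fun i => congrFun (List.ofFn_injective h) i
  · intro l hl
    have hlen : l.length = n := by simpa using length_of_mem_arrangements hl
    have hinj : Function.Injective fun i : Fin n => l.get (i.cast hlen.symm) :=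
      (List.nodup_iff_injective_get.1 (mem_arrangements.1 hl).1).comp (Fin.cast_injective _)
    refine ⟨Equiv.ofBijective _ (Finite.injective_iff_bijective.1 hinj), Finset.mem_univ _, ?_⟩
    refine List.ext_get (by simp [hlen]) fun i h₁ h₂ => ?_
    simp
  · simp

section Series

open PowerSeries

variable {m b r : ℕ}

theorem residue_series_mul (hm : 1 ≤ m) (hb : 1 ≤ b) (hr : 2 ≤ r)
    (p : ℕ → Prop) [DecidablePred p]
    (hp : ∀ n, p n ↔ ∃ j ≤ r - 1, n % (m * r * b) = j * b) :
    (PowerSeries.mk fun n => if p n then (1 : ℚ) else 0) * (1 - X ^ (m * r * b)) =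
      ∑ j ∈ Finset.range r, (X ^ b) ^ j := by
  have hlt : ∀ j ≤ r - 1, j * b < m * r * b := fun j hj =>
    Nat.mul_lt_mul_of_pos_right (by nlinarith [Nat.sub_add_cancel (by omega : 1 ≤ r)]) hb
  ext n
  rw [mul_sub, mul_one, map_sub, coeff_mul_X_pow', map_sum]
  simp only [coeff_mk, ← pow_mul, coeff_X_pow]
  by_cases hn : m * r * b ≤ n
  · have : p (n - m * r * b) ↔ p n := by
      rw [hp, hp, ← Nat.mod_eq_sub_mod hn]
    rw [if_pos hn, Finset.sum_eq_zero]
    · simp [this]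
    · intro j hj
      have := hlt j (by have := Finset.mem_range.1 hj; omega)
      rw [if_neg]
      rw [mul_comm b j]
      omega
  · rw [if_neg hn, sub_zero]
    by_cases h : p n
    · obtain ⟨j, hj, hjn⟩ := (hp n).1 h
      rw [Nat.mod_eq_of_lt (by omega)] at hjn
      rw [if_pos h, Finset.sum_eq_single j]
      · rw [if_pos (by rw [hjn, mul_comm])]
      · intro i _ hij
        rw [if_neg]
        rw [hjn, mul_comm]
        exact fun h => hij (Nat.eq_of_mul_eq_mul_left hb h).symm
      · intro h
        exact absurd (Finset.mem_range.2 (by omega)) h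
    · rw [if_neg h, Finset.sum_eq_zero]
      intro j hj
      rw [if_neg]
      rintro rfl
      refine h ((hp _).2 ⟨j, by have := Finset.mem_range.1 hj; omega, ?_⟩)
      rw [Nat.mod_eq_of_lt (by omega), mul_comm]

theorem alternating_series_mul_residue_series (hm : 1 ≤ m) (hb : 1 ≤ b) (hr : 2 ≤ r)
    (p : ℕ → Prop) [DecidablePred p]
    (hp : ∀ n, p n ↔ ∃ j ≤ r - 1, n % (m * r * b) = j * b) :
    (∑ k ∈ Finset.range m, (X ^ (k * r * b) - X ^ ((k * r + 1) * b) : ℚ⟦X⟧)) *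
      (PowerSeries.mk fun n => if p n then (1 : ℚ) else 0) = 1 := by
  have hA : (∑ k ∈ Finset.range m, (X ^ (k * r * b) - X ^ ((k * r + 1) * b) : ℚ⟦X⟧)) =
      (1 - X ^ b) * ∑ k ∈ Finset.range m, (X ^ (r * b)) ^ k := by
    rw [Finset.mul_sum]
    refine Finset.sum_congr rfl fun k _ => ?_
    ring
  have hne : (1 - X ^ (r * b) : ℚ⟦X⟧) ≠ 0 := by
    intro h
    have := congrArg (constantCoeff (R := ℚ)) h
    have hrb : r * b ≠ 0 := by positivity
    simp [hrb] at this
  have hW := residue_series_mul hm hb hr p hp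
  have h₁ := geom_sum_mul_neg (X ^ b : ℚ⟦X⟧) r
  have h₂ := geom_sum_mul_neg (X ^ (r * b) : ℚ⟦X⟧) m
  rw [← hW] at h₁
  have e₁ : ((X : ℚ⟦X⟧) ^ b) ^ r = X ^ (r * b) := by ring
  have e₂ : ((X : ℚ⟦X⟧) ^ (r * b)) ^ m = X ^ (m * r * b) := by ring
  rw [e₁] at h₁
  rw [e₂] at h₂
  rw [hA]
  apply mul_right_cancel₀ hne
  linear_combination
    (1 - X ^ b) * (PowerSeries.mk fun n => if p n then (1 : ℚ) else 0) * h₂ + h₁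

end Series

/-- Gessel, Proposition 2.4. For positive integers `m`, `b` and `r ≥ 2`,
the coefficients `c n` of the reciprocal of
`∑_{k=0}^{m-1} (x^{krb}/(krb)! - x^{(kr+1)b}/((kr+1)b)!)`, written as `∑ cₙ xⁿ/n!`, count
the permutations of `{1, ..., n}` in which every maximal increasing run has length
congruent modulo `mrb` to one of `0, b, 2b, ..., (r-1)b`. -/
theorem stmt13 (m b r : ℕ) (hm : 1 ≤ m) (hb : 1 ≤ b) (hr : 2 ≤ r) (c : ℕ → ℚ)
    (hc : (∑ k ∈ Finset.range m,
          (PowerSeries.monomial (R := ℚ) (k * r * b) ((1 : ℚ) / (k * r * b).factorial)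
            - PowerSeries.monomial (R := ℚ) ((k * r + 1) * b) ((1 : ℚ) / ((k * r + 1) * b).factorial)))⁻¹
        = PowerSeries.mk fun n => c n / n.factorial) :
    ∀ n, c n = (Nat.card {σ : Equiv.Perm (Fin n) //
        ∀ l ∈ runLengths σ, ∃ j ≤ r - 1, l % (m * r * b) = j * b} : ℚ) := by
  classical
  intro n
  set p : ℕ → Prop := fun l => ∃ j ≤ r - 1, l % (m * r * b) = j * b with hp
  set A : PowerSeries ℚ := ∑ k ∈ Finset.range m,
    (PowerSeries.X ^ (k * r * b) - PowerSeries.X ^ ((k * r + 1) * b)) with hA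
  set w : ℕ → ℚ := fun k => if p k then 1 else 0 with hw
  set a : ℕ → ℚ := fun k => PowerSeries.coeff k A with ha
  have hAW : A * PowerSeries.mk w = 1 :=
    alternating_series_mul_residue_series hm hb hr p fun _ => Iff.rfl
  have hE : (∑ k ∈ Finset.range m,
      (PowerSeries.monomial (R := ℚ) (k * r * b) ((1 : ℚ) / (k * r * b).factorial)
        - PowerSeries.monomial (R := ℚ) ((k * r + 1) * b)
          ((1 : ℚ) / ((k * r + 1) * b).factorial))) = PowerSeries.mk fun n => a n / n.factorial := by
    ext i
    simp only [ha, hA, map_sum, map_sub, PowerSeries.coeff_monomial, PowerSeries.coeff_X_pow,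
      PowerSeries.coeff_mk, Finset.sum_div, sub_div]
    refine Finset.sum_congr rfl fun k _ => ?_
    congr 1
    · split_ifs with h
      · rw [h]
      · simp
    · split_ifs with h
      · rw [h]
      · simp
  have hw0 : w 0 = 1 := if_pos ⟨0, by simp⟩
  have haw : ∀ n, ∑ k ∈ Finset.range (n + 1), a k * w (n - k) = if n = 0 then 1 else 0 := by
    intro n
    have := congrArg (PowerSeries.coeff n) hAW
    rwa [PowerSeries.coeff_mul, Finset.Nat.sum_antidiagonal_eq_sum_range_succ_mk,
      PowerSeries.coeff_one, Finset.sum_congr rfl fun k _ => by rw [PowerSeries.coeff_mk]] at this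
  have ha0 : a 0 = 1 := by simpa [hw0] using haw 0
  rw [hE, PowerSeries.inv_eq_iff_mul_eq_one
    (by simp [← PowerSeries.coeff_zero_eq_constantCoeff_apply, ha0]), mul_comm] at hc
  have hac : ∀ n, ∑ k ∈ Finset.range (n + 1), n.choose k * (a k * c (n - k)) =
      if n = 0 then 1 else 0 := by
    intro n
    have := congrArg (fun f => (n.factorial : ℚ) * PowerSeries.coeff n f) hc
    simp only [PowerSeries.coeff_mul, Finset.Nat.sum_antidiagonal_eq_sum_range_succ_mk,
      PowerSeries.coeff_one, PowerSeries.coeff_mk, Finset.mul_sum] at this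
    rw [Finset.sum_congr rfl fun k hk => ?_, this]
    · split_ifs with h <;> simp [h]
    · rw [Nat.cast_choose ℚ (Nat.lt_succ_iff.1 (Finset.mem_range.1 hk))]
      field_simp
  have hsum := sum_arrangements_runWeight hw0 ha0 (fun n hn => by rw [haw, if_neg hn]) hac
    (Finset.univ : Finset (Fin n))
  rw [Finset.card_univ, Fintype.card_fin, ← sum_perm_ofFn] at hsum
  rw [← hsum, Nat.card_eq_fintype_card, Fintype.card_subtype, ← Finset.sum_boole]
  exact Finset.sum_congr rfl fun σ _ => runWeight_indicator p _
end

section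
/- Let b ≥ 1 and r ≥ 2 be integers, let O* = {(kr+1)b : k ≥ 0} and E* = {krb : k ≥ 1}, and let A ⊆ O* and B ⊆ E* with b ∈ A, such that for every k ≥ 1 with krb ∈ B, both (kr+1)b ∈ A and ((k-1)r+1)b ∈ A. Then every coefficient of the reciprocal of the ordinary power series g(x) = 1 - Σ_{a∈A} x^a + Σ_{m∈B} x^m in ℚ[[x]] is nonnegative. -/
open scoped Classical

/-- A power series with constant coefficient `1` whose higher coefficients are nonpositive has a
reciprocal with nonnegative coefficients. -/
theorem PowerSeries.coeff_inv_nonneg_s15 {h : PowerSeries ℚ} (h0 : PowerSeries.coeff 0 h = 1)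
    (hneg : ∀ n, n ≠ 0 → PowerSeries.coeff n h ≤ 0) (n : ℕ) :
    0 ≤ PowerSeries.coeff n h⁻¹ := by
  induction n using Nat.strong_induction_on with
  | _ n ih =>
    rw [PowerSeries.coeff_inv]
    rw [PowerSeries.coeff_zero_eq_constantCoeff] at h0
    split_ifs with hn
    · simp [h0]
    · rw [h0, inv_one, neg_mul, one_mul, neg_nonneg]
      refine Finset.sum_nonpos fun p hp => ?_
      rw [Finset.HasAntidiagonal.mem_antidiagonal] at hp
      split_ifs with hlt
      · exact mul_nonpos_of_nonpos_of_nonneg (hneg _ (by omega)) (ih _ hlt)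
      · exact le_rfl

/-- For `b ≥ 1`, `r ≥ 2`, `A` a subset of the stretched odds
`{(kr+1)b : k ≥ 0}` containing `b`, and `B` a subset of the stretched evens
`{krb : k ≥ 1}`, with `A ∪ B` odd-ended in the stretched sense, every coefficient of
the reciprocal of the ordinary power series `g(x) = 1 - ∑_{a ∈ A} x^a + ∑_{m ∈ B} x^m`
in `ℚ[[x]]` is nonnegative. -/
theorem stmt15 (b r : ℕ) (hb : 1 ≤ b) (hr : 2 ≤ r)
    (A B : Set ℕ)
    (hA : ∀ a ∈ A, ∃ k : ℕ, a = (k * r + 1) * b)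
    (hB : ∀ m ∈ B, ∃ k : ℕ, 1 ≤ k ∧ m = k * r * b)
    (hbA : b ∈ A)
    (hOE : ∀ k : ℕ, 1 ≤ k → k * r * b ∈ B →
      (k * r + 1) * b ∈ A ∧ ((k - 1) * r + 1) * b ∈ A) :
    ∀ n, 0 ≤ PowerSeries.coeff (R := ℚ) n
      (PowerSeries.mk fun k =>
          (if k = 0 then (1 : ℚ) else 0)
          - (if k ∈ A then (1 : ℚ) else 0)
          + (if k ∈ B then (1 : ℚ) else 0))⁻¹ := by
  set g : PowerSeries ℚ := PowerSeries.mk fun k =>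
    (if k = 0 then (1 : ℚ) else 0) - (if k ∈ A then (1 : ℚ) else 0)
      + (if k ∈ B then (1 : ℚ) else 0) with hg
  have h0A : 0 ∉ A := by
    intro h
    obtain ⟨k, hk⟩ := hA 0 h
    have : 0 < (k * r + 1) * b := by positivity
    omega
  have h0B : 0 ∉ B := by
    intro h
    obtain ⟨k, hk, hkr⟩ := hB 0 h
    have : 0 < k * r * b := by positivity
    omega
  have hg0 : PowerSeries.constantCoeff g = 1 := by
    rw [← PowerSeries.coeff_zero_eq_constantCoeff_apply, hg, PowerSeries.coeff_mk]
    simp [h0A, h0B]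
  obtain ⟨s, rfl⟩ : ∃ s, r = s + 1 := ⟨r - 1, by omega⟩
  set S : PowerSeries ℚ := ∑ i ∈ Finset.range (s + 1), PowerSeries.X ^ (i * b) with hS
  have hS_nonneg : ∀ n, 0 ≤ PowerSeries.coeff n S := by
    intro n
    rw [hS, map_sum]
    refine Finset.sum_nonneg fun i _ => ?_
    rw [PowerSeries.coeff_X_pow]
    split_ifs <;> norm_num
  have hS0 : PowerSeries.constantCoeff S = 1 := by
    rw [hS, Finset.sum_range_succ']
    have : b ≠ 0 := by omega
    simp [this]
  have hneg : ∀ n, n ≠ 0 → PowerSeries.coeff n (S * g) ≤ 0 := by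
    intro n hn
    let e : ℕ → ℚ := fun i => if i * b ≤ n ∧ (n - i * b = 0 ∨ n - i * b ∈ B) then 1 else 0
    let a : ℕ → ℚ := fun i => if i * b ≤ n ∧ n - i * b ∈ A then 1 else 0
    have hterm : ∀ i, PowerSeries.coeff n (PowerSeries.X ^ (i * b) * g) = e i - a i := by
      intro i
      rw [PowerSeries.coeff_X_pow_mul', hg, PowerSeries.coeff_mk]
      by_cases h : i * b ≤ n
      · by_cases hz : n - i * b = 0
        · simp [e, a, h, hz, h0A, h0B]
        · simp only [e, a, h, hz, true_and, false_or, if_true, if_false]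
          ring
      · simp [e, a, h]
    have hshift : ∀ i, e (i + 1) ≤ a i := by
      intro i
      by_cases h : (i + 1) * b ≤ n ∧ (n - (i + 1) * b = 0 ∨ n - (i + 1) * b ∈ B)
      · obtain ⟨hle, h⟩ := h
        have hib : (i + 1) * b = i * b + b := by ring
        have hmem : n - i * b ∈ A := by
          rcases h with h | h
          · rwa [show n - i * b = b by omega]
          · obtain ⟨k, hk, hkr⟩ := hB _ h
            have := (hOE k hk (hkr ▸ h)).1
            rwa [show n - i * b = (k * (s + 1) + 1) * b by rw [add_one_mul]; omega]
        have hle' : i * b ≤ n := by omega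
        simp only [e, a, hmem, hle', and_self, if_true]
        split_ifs <;> norm_num
      · simp only [e, a, h, if_false]
        split_ifs <;> norm_num
    have hwrap : e 0 ≤ a s := by
      by_cases h : n ∈ B
      · obtain ⟨k, hk, hkr⟩ := hB _ h
        have hmem := (hOE k hk (hkr ▸ h)).2
        obtain ⟨j, rfl⟩ : ∃ j, k = j + 1 := ⟨k - 1, by omega⟩
        rw [Nat.add_sub_cancel] at hmem
        have hn' : n = (j * (s + 1) + 1) * b + s * b := by rw [hkr]; ring
        have hle : s * b ≤ n := by omega
        have hsub : n - s * b = (j * (s + 1) + 1) * b := by omega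
        simp only [e, a, hsub, hmem, hle, and_self, if_true]
        split_ifs <;> norm_num
      · simp only [e, a, zero_mul, Nat.sub_zero, hn, h, or_self, and_false, if_false]
        split_ifs <;> norm_num
    rw [hS, Finset.sum_mul, map_sum, Finset.sum_congr rfl fun i _ => hterm i,
      Finset.sum_sub_distrib, Finset.sum_range_succ', Finset.sum_range_succ a]
    have := Finset.sum_le_sum fun i (_ : i ∈ Finset.range s) => hshift i
    linarith
  have hinv : g⁻¹ = S * (S * g)⁻¹ := by
    have hS_ne : PowerSeries.constantCoeff S ≠ 0 := by simp [hS0]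
    rw [PowerSeries.mul_inv_rev, mul_comm, mul_assoc, PowerSeries.inv_mul_cancel _ hS_ne, mul_one]
  intro n
  rw [hinv, PowerSeries.coeff_mul]
  exact Finset.sum_nonneg fun p _ => mul_nonneg (hS_nonneg _)
    (PowerSeries.coeff_inv_nonneg_s15 (by simp [hS0, hg0]) hneg _)
end
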